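/- For 1 ≤ k ≤ n, the images in S_{n,k} = ℚ[x_1,…,x_n]/J_{n,k} of the monomials x_1^{c_1} ⋯ x_n^{c_n}, as (c_1,…,c_n) = codē(σ) ranges over the boosted coinversion codes of all ordered set partitions σ of [n] with at least k blocks, form a basis of S_{n,k} as a ℚ-vector space. -/

import Mathlib

open scoped BigOperators

namespace PackedWords

/-- An ordered set partition of `[n] = {1, …, n}` with `k` blocks: a sequence
`B_1 | ⋯ | B_k` of nonempty pairwise disjoint subsets of `[n]` whose union is `[n]`. -/
structure OSP (n k : ℕ) where
  blocks : Fin k → Finset ℕ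
  subset_range : ∀ j, blocks j ⊆ Finset.Icc 1 n
  blocks_nonempty : ∀ j, (blocks j).Nonempty
  blocks_disjoint : ∀ j₁ j₂ : Fin k, j₁ ≠ j₂ → Disjoint (blocks j₁) (blocks j₂)
  cover : ∀ i ∈ Finset.Icc 1 n, ∃ j, i ∈ blocks j

/-- Common generalization of the coinversion code (`b = 0`) and the boosted
coinversion code (`b = 1`).  Position `p : Fin n` corresponds to the letter
`i = p + 1` of `[n]`.  If `i ∈ B_j` (blocks indexed `0, …, k-1`, so `j` here is
the paper's `j - 1`), then `c_i = #{ℓ > j : min B_ℓ > i}` if `i = min B_j`, and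
`c_i = #{ℓ > j : min B_ℓ > i} + (j - 1) + b` (in the paper's 1-indexing) otherwise. -/
noncomputable def codeAux {n k : ℕ} (b : ℕ) (σ : OSP n k) (p : Fin n) : ℕ :=
  if h : ∃ j, ((p : ℕ) + 1) ∈ σ.blocks j then
    (Finset.univ.filter fun ℓ : Fin k =>
        h.choose < ℓ ∧ ∀ x ∈ σ.blocks ℓ, (p : ℕ) + 1 < x).card
      + (if ∀ x ∈ σ.blocks h.choose, (p : ℕ) + 1 ≤ x then 0 else (h.choose : ℕ) + b)
  else 0

/-- The coinversion code of an ordered set partition. -/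
noncomputable def code {n k : ℕ} (σ : OSP n k) : Fin n → ℕ := codeAux 0 σ

/-- The boosted coinversion code of an ordered set partition. -/
noncomputable def bcode {n k : ℕ} (σ : OSP n k) : Fin n → ℕ := codeAux 1 σ

/-- The skip sequence of a finite set `S = {s_1 < s_2 < ⋯} ⊆ ℕ`:
`γ_i = i - j + 1` if `i = s_j ∈ S`, and `γ_i = 0` otherwise. -/
def skip (S : Finset ℕ) (i : ℕ) : ℕ :=
  if i ∈ S then i - (S.filter (· < i)).card else 0

/-- The reverse skip sequence `γ(S)* = (γ_n, …, γ_1)` of `S ⊆ [n]`, read at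
position `p : Fin n` (so position `p` carries `γ_{n - p}` in 1-indexed terms). -/
def revSkipAt (n : ℕ) (S : Finset ℕ) (p : Fin n) : ℕ := skip S (n - (p : ℕ))

/-- For `T ⊆ [n-1]` with skip sequence `γ = γ(T)`, the length-`n` sequence
`(γ_{n-1}, …, γ_i, d, γ_{i-1}, …, γ_1)` obtained from the reverse skip sequence of `T`
by inserting `d` in position `n - i + 1` (1-indexed), read at position `p : Fin n`. -/
def insSeq (n i d : ℕ) (T : Finset ℕ) (p : Fin n) : ℕ :=
  if (p : ℕ) + 1 ≤ n - i then skip T (n - ((p : ℕ) + 1))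
  else if (p : ℕ) + 1 = n - i + 1 then d
  else skip T (n - ((p : ℕ) + 1) + 1)

/-- `Packedk n k w`: `w` is a packed word of length `n` on the alphabet of positive
integers (whenever `i + 1` appears as a letter, so does `i`) in which each of the
letters `1, 2, …, k` appears. -/
def Packedk (n k : ℕ) (w : Fin n → ℕ) : Prop :=
  (∀ p, 1 ≤ w p) ∧ (∀ i, 1 ≤ i → (∃ p, w p = i + 1) → ∃ p, w p = i) ∧
    (∀ j, 1 ≤ j → j ≤ k → ∃ p, w p = j)

/-- The elementary symmetric polynomial of degree `a` in the variables `X j`, `j ∈ s`. -/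
noncomputable def esymmOn (n : ℕ) (s : Finset (Fin n)) (a : ℕ) : MvPolynomial (Fin n) ℚ :=
  ∑ t ∈ s.powersetCard a, ∏ j ∈ t, MvPolynomial.X j

/-- The complete homogeneous symmetric polynomial of degree `b` evaluated at
`α 1, α 2, …, α d`. -/
noncomputable def hval (b d : ℕ) (α : ℕ → ℚ) : ℚ :=
  ∑ m : Sym (Fin d) b, ((m : Multiset (Fin d)).map fun j => α ((j : ℕ) + 1)).prod

/-- The locus `X_{n,k} ⊆ ℚ^n` of points `(α_{w_1}, …, α_{w_n})` for `w ∈ W_{n,k}`. -/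
def packedPoints (n k : ℕ) (α : ℕ → ℚ) : Set (Fin n → ℚ) :=
  {x | ∃ w : Fin n → ℕ, Packedk n k w ∧ x = fun p => α (w p)}

/-- The ideal `J_n = ⟨x_i^d e_{n-r}^{(i)} : 1 ≤ i ≤ n, 1 ≤ r ≤ d⟩`. -/
noncomputable def Jn (n : ℕ) : Ideal (MvPolynomial (Fin n) ℚ) :=
  Ideal.span {g | ∃ (i : Fin n) (r d : ℕ), 1 ≤ r ∧ r ≤ d ∧
    g = MvPolynomial.X i ^ d * esymmOn n {i}ᶜ (n - r)}

/-- The ideal `J_{n,k} = J_n + ⟨e_n, e_{n-1}, …, e_{n-k+1}⟩`. -/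
noncomputable def Jnk (n k : ℕ) : Ideal (MvPolynomial (Fin n) ℚ) :=
  Jn n ⊔ Ideal.span {g | ∃ j : ℕ, n - k + 1 ≤ j ∧ j ≤ n ∧ g = esymmOn n Finset.univ j}

/-- The Haglund–Rhoades–Shimozono ideal
`I_{n,k} = ⟨x_1^k, …, x_n^k, e_n, e_{n-1}, …, e_{n-k+1}⟩`. -/
noncomputable def Ink (n k : ℕ) : Ideal (MvPolynomial (Fin n) ℚ) :=
  Ideal.span ({g | ∃ i : Fin n, g = MvPolynomial.X i ^ k} ∪
    {g | ∃ j : ℕ, n - k + 1 ≤ j ∧ j ≤ n ∧ g = esymmOn n Finset.univ j})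

/-- `T(X)`: the ideal generated by the top-degree homogeneous components `τ(f)` of
all nonzero polynomials `f` vanishing on `X`. -/
noncomputable def gradedIdeal (n : ℕ) (X : Set (Fin n → ℚ)) : Ideal (MvPolynomial (Fin n) ℚ) :=
  Ideal.span {g | ∃ f : MvPolynomial (Fin n) ℚ, f ≠ 0 ∧
    (∀ x ∈ X, MvPolynomial.eval x f = 0) ∧
    g = MvPolynomial.homogeneousComponent f.totalDegree f}

/-- The degree-`d` homogeneous component of the quotient `ℚ[x_1, …, x_n]/I`,
namely the image of the space of homogeneous polynomials of degree `d`. -/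
noncomputable def quotComp (n : ℕ) (I : Ideal (MvPolynomial (Fin n) ℚ)) (d : ℕ) :
    Submodule ℚ (MvPolynomial (Fin n) ℚ ⧸ I) :=
  Submodule.map (Ideal.Quotient.mkₐ ℚ I).toLinearMap
    (MvPolynomial.homogeneousSubmodule (Fin n) ℚ d)

/-- The degree-`(d - a)` homogeneous component of `ℚ[x_1, …, x_n]/I`, interpreted as
zero when `d - a < 0` (degree shift by `a`). -/
noncomputable def quotCompShift (n : ℕ) (I : Ideal (MvPolynomial (Fin n) ℚ)) (d a : ℕ) :
    Submodule ℚ (MvPolynomial (Fin n) ℚ ⧸ I) :=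
  if a ≤ d then quotComp n I (d - a) else ⊥

lemma packedk_comp {n k : ℕ} {w : Fin n → ℕ} (σ : Equiv.Perm (Fin n)) (h : Packedk n k w) :
    Packedk n k (w ∘ σ) := by
  obtain ⟨h1, h2, h3⟩ := h
  refine ⟨fun p => h1 _, fun i hi hex => ?_, fun j hj hjk => ?_⟩
  · obtain ⟨q, hq⟩ := h2 i hi (by obtain ⟨p, hp⟩ := hex; exact ⟨σ p, hp⟩)
    exact ⟨σ.symm q, by simpa using hq⟩
  · obtain ⟨q, hq⟩ := h3 j hj hjk
    exact ⟨σ.symm q, by simpa using hq⟩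

/-- The left action of a permutation `σ ∈ S_n` on packed words, sending `w` to
`w ∘ σ⁻¹` (the permutation action on positions). -/
noncomputable def wordPerm (n k : ℕ) (σ : Equiv.Perm (Fin n)) :
    {w : Fin n → ℕ // Packedk n k w} ≃ {w : Fin n → ℕ // Packedk n k w} where
  toFun w := ⟨w.1 ∘ σ.symm, packedk_comp σ.symm w.2⟩
  invFun w := ⟨w.1 ∘ σ, packedk_comp σ w.2⟩
  left_inv w := Subtype.ext (funext fun p => by simp)
  right_inv w := Subtype.ext (funext fun p => by simp)

lemma mul_mem_of_mem_span {R : Type*} [CommRing R] {I : Ideal R} {S : Set R} {a f : R}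
    (hf : f ∈ Ideal.span S) (h : ∀ g ∈ S, a * g ∈ I) : a * f ∈ I := by
  induction hf using Submodule.span_induction with
  | mem g hg => exact h g hg
  | zero => simp
  | add f g _ _ hf hg => rw [mul_add]; exact add_mem hf hg
  | smul r f _ hf => rw [smul_eq_mul, mul_left_comm]; exact I.mul_mem_left r hf

open MvPolynomial in
lemma esymmOn_zero {n : ℕ} (s : Finset (Fin n)) : esymmOn n s 0 = 1 := by
  simp [esymmOn]

open MvPolynomial in
lemma esymmOn_insert_succ {n : ℕ} {a : Fin n} {s : Finset (Fin n)} (ha : a ∉ s) (j : ℕ) :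
    esymmOn n (insert a s) (j + 1) = esymmOn n s (j + 1) + X a * esymmOn n s j := by
  have hmem : ∀ t ∈ s.powersetCard j, a ∉ t := fun t ht hat =>
    ha ((Finset.mem_powersetCard.mp ht).1 hat)
  unfold esymmOn
  rw [Finset.powersetCard_succ_insert ha, Finset.sum_union, Finset.sum_image, Finset.mul_sum]
  · congr 1
    exact Finset.sum_congr rfl fun t ht => Finset.prod_insert (hmem t ht)
  · intro t ht u hu htu
    rw [← Finset.erase_insert (hmem t ht), ← Finset.erase_insert (hmem u hu)]
    exact congrArg (Finset.erase · a) htu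
  · rw [Finset.disjoint_left]
    intro t ht ht'
    obtain ⟨u, -, rfl⟩ := Finset.mem_image.mp ht'
    exact ha ((Finset.mem_powersetCard.mp ht).1 (Finset.mem_insert_self a u))

lemma esymmOn_eq_zero {n : ℕ} {s : Finset (Fin n)} {j : ℕ} (h : s.card < j) :
    esymmOn n s j = 0 := by
  simp [esymmOn, Finset.powersetCard_eq_empty.mpr h]

/-- The ideal generated by the elementary symmetric polynomials in the variables indexed by `s`
of the top `k` degrees `|s|, …, |s| - k + 1`. -/
noncomputable def topEsymmIdeal (n : ℕ) (s : Finset (Fin n)) (k : ℕ) :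
    Ideal (MvPolynomial (Fin n) ℚ) :=
  Ideal.span {g | ∃ j, s.card < j + k ∧ g = esymmOn n s j}

lemma esymmOn_mem_topEsymmIdeal {n : ℕ} {s : Finset (Fin n)} {j k : ℕ} (h : s.card < j + k) :
    esymmOn n s j ∈ topEsymmIdeal n s k :=
  Ideal.subset_span ⟨j, h, rfl⟩

lemma topEsymmIdeal_le_insert {n : ℕ} {a : Fin n} {s : Finset (Fin n)} (ha : a ∉ s) (k : ℕ) :
    topEsymmIdeal n s k ≤
      topEsymmIdeal n (insert a s) (k + 1) ⊔ Ideal.span {MvPolynomial.X a} := by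
  refine Ideal.span_le.mpr ?_
  rintro _ ⟨j, hj, rfl⟩
  have hcard : (insert a s).card < j + (k + 1) := by
    rw [Finset.card_insert_of_notMem ha]; omega
  have hmem : esymmOn n (insert a s) j ∈
      topEsymmIdeal n (insert a s) (k + 1) ⊔ Ideal.span {MvPolynomial.X a} :=
    Ideal.mem_sup_left (esymmOn_mem_topEsymmIdeal hcard)
  cases j with
  | zero => simpa only [esymmOn_zero, SetLike.mem_coe] using hmem
  | succ j =>
    rw [esymmOn_insert_succ ha] at hmem
    exact (Submodule.add_mem_iff_left _ (Ideal.mem_sup_right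
      (Ideal.mul_mem_right _ _ (Ideal.mem_span_singleton_self _)))).mp hmem

lemma X_pow_mul_esymmOn_mem {n : ℕ} {a : Fin n} {s : Finset (Fin n)} (ha : a ∉ s) {k : ℕ} :
    ∀ {r j : ℕ}, r ≤ k → s.card < j + r →
      MvPolynomial.X a ^ r * esymmOn n s j ∈ topEsymmIdeal n (insert a s) k
  | 0, j, _, hj => by simp [esymmOn_eq_zero (show s.card < j by omega)]
  | r + 1, j, hr, hj => by
    have hmem : esymmOn n (insert a s) (j + 1) ∈ topEsymmIdeal n (insert a s) k :=
      esymmOn_mem_topEsymmIdeal (by rw [Finset.card_insert_of_notMem ha]; omega)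
    have ih : MvPolynomial.X a ^ r * esymmOn n s (j + 1) ∈ topEsymmIdeal n (insert a s) k :=
      X_pow_mul_esymmOn_mem ha (by omega) (by omega)
    have key := sub_mem (Ideal.mul_mem_left _ (MvPolynomial.X a ^ r) hmem) ih
    rw [esymmOn_insert_succ ha] at key
    convert key using 1
    ring

lemma X_pow_mul_mem_topEsymmIdeal {n : ℕ} {a : Fin n} {s : Finset (Fin n)} (ha : a ∉ s) {k : ℕ}
    {f : MvPolynomial (Fin n) ℚ} (hf : f ∈ topEsymmIdeal n s k) :
    MvPolynomial.X a ^ k * f ∈ topEsymmIdeal n (insert a s) k := by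
  refine mul_mem_of_mem_span hf ?_
  rintro _ ⟨j, hj, rfl⟩
  exact X_pow_mul_esymmOn_mem ha le_rfl hj

/-- The ideal spanned by the monomials that are lexicographically larger than `c`. -/
noncomputable def lexAbove {n : ℕ} (c : Fin n →₀ ℕ) : Ideal (MvPolynomial (Fin n) ℚ) :=
  Ideal.span ((fun b => MvPolynomial.monomial b 1) '' {b | toLex ⇑c < toLex ⇑b})

lemma mem_lexAbove {n : ℕ} {c : Fin n →₀ ℕ} {f : MvPolynomial (Fin n) ℚ} :
    f ∈ lexAbove c ↔ ∀ b ∈ f.support, toLex ⇑c < toLex ⇑b := by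
  rw [lexAbove, MvPolynomial.mem_ideal_span_monomial_image]
  refine forall₂_congr fun b _ => ⟨?_, fun h => ⟨b, h, le_rfl⟩⟩
  rintro ⟨d, hd, hdb⟩
  exact lt_of_lt_of_le hd (Pi.toLex_monotone hdb)

lemma monomial_mul_mem_lexAbove {n : ℕ} {c : Fin n →₀ ℕ} (u : Fin n →₀ ℕ)
    {f : MvPolynomial (Fin n) ℚ} (hf : f ∈ lexAbove c) :
    MvPolynomial.monomial u 1 * f ∈ lexAbove (u + c) := by
  refine mul_mem_of_mem_span hf ?_
  rintro _ ⟨b, ⟨p, hlt, hp⟩, rfl⟩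
  refine Ideal.subset_span ⟨u + b, ⟨p, fun q hq => ?_, ?_⟩, ?_⟩
  · simpa using hlt q hq
  · simpa using hp
  · simp [MvPolynomial.monomial_mul]

/-- Scanning a list from right to left, count the entries that do not exceed the current count. -/
def scan : List ℕ → ℕ
  | [] => 0
  | c :: l => if c ≤ scan l then scan l + 1 else scan l

lemma scan_le_of_sublist {l₁ l₂ : List ℕ} (h : l₁.Sublist l₂) : scan l₁ ≤ scan l₂ := by
  induction h with
  | slnil => rfl
  | cons a _ ih => simp only [scan]; split_ifs <;> omega
  | cons_cons a _ ih => simp only [scan]; split_ifs <;> omega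

theorem monomial_mem_topEsymmIdeal_sup_lexAbove {n : ℕ} (l : List (Fin n)) :
    l.Pairwise (· < ·) → ∀ (k : ℕ) (c : Fin n →₀ ℕ), (∀ i ∉ l, c i = 0) → scan (l.map c) < k →
      MvPolynomial.monomial c 1 ∈ topEsymmIdeal n l.toFinset k ⊔ lexAbove c := by
  induction l with
  | nil =>
    intro _ k c hc hk
    have h0 : c = 0 := Finsupp.ext fun i => hc i (by simp)
    subst h0
    refine Ideal.mem_sup_left ?_
    have hmem := esymmOn_mem_topEsymmIdeal (n := n) (s := ∅) (j := 0) (k := k)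
      (by simpa [scan] using hk)
    rwa [esymmOn_zero] at hmem
  | cons a l ih =>
    intro hl k c hc hk
    obtain ⟨hal, hl⟩ := List.pairwise_cons.mp hl
    have ha : a ∉ l := fun h => lt_irrefl _ (hal a h)
    have ha' : a ∉ l.toFinset := by simpa using ha
    have hc' : ∀ i ∉ l, c.erase a i = 0 := fun i hi => by
      by_cases hia : i = a
      · simp [hia]
      · rw [Finsupp.erase_ne hia]; exact hc i (by simp [hia, hi])
    have hmap : l.map (c.erase a) = l.map c := List.map_congr_left fun i hi =>
      Finsupp.erase_ne fun h => ha (h ▸ hi)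
    have hsplit : Finsupp.single a (c a) + c.erase a = c := Finsupp.single_add_erase a c
    have hmon : (MvPolynomial.monomial c 1 : MvPolynomial (Fin n) ℚ) =
        MvPolynomial.monomial (Finsupp.single a (c a)) 1 *
          MvPolynomial.monomial (c.erase a) 1 := by
      rw [MvPolynomial.monomial_mul, hsplit, one_mul]
    have hX : (MvPolynomial.monomial (Finsupp.single a (c a)) 1 : MvPolynomial (Fin n) ℚ) =
        MvPolynomial.X a ^ c a := (MvPolynomial.X_pow_eq_monomial).symm
    rw [List.toFinset_cons]
    simp only [List.map_cons, scan] at hk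
    by_cases h : scan (l.map c) + 1 < k
    · obtain ⟨k, rfl⟩ : ∃ m, k = m + 1 := ⟨k - 1, by omega⟩
      have hih := ih hl k (c.erase a) hc' (by rw [hmap]; omega)
      obtain ⟨f, hf, g, hg, hfg⟩ := Submodule.mem_sup.mp hih
      obtain ⟨f₁, hf₁, f₂, hf₂, hff⟩ := Submodule.mem_sup.mp (topEsymmIdeal_le_insert ha' k hf)
      rw [hmon, ← hfg, ← hff, mul_add, mul_add]
      refine add_mem (add_mem (Ideal.mem_sup_left (Ideal.mul_mem_left _ _ hf₁)) ?_) ?_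
      · obtain ⟨q, rfl⟩ := Ideal.mem_span_singleton'.mp hf₂
        refine Ideal.mem_sup_right ?_
        have hpow : (MvPolynomial.X a ^ (c a + 1) : MvPolynomial (Fin n) ℚ) ∈ lexAbove c := by
          rw [MvPolynomial.X_pow_eq_monomial]
          refine Ideal.subset_span ⟨_, ⟨a, fun q hq => ?_, ?_⟩, rfl⟩
          · have hq0 : c q = 0 := hc q fun hqm => by
              rcases List.mem_cons.mp hqm with h | h
              · exact hq.ne h
              · exact lt_asymm hq (hal q h)
            simp [hq0, hq.ne']
          · simp
        rw [hX, show MvPolynomial.X a ^ c a * (q * MvPolynomial.X a) =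
          q * MvPolynomial.X a ^ (c a + 1) by ring]
        exact Ideal.mul_mem_left _ _ hpow
      · have hmem := monomial_mul_mem_lexAbove (Finsupp.single a (c a)) hg
        rw [hsplit] at hmem
        exact Ideal.mem_sup_right hmem
    · have hca : k ≤ c a := by split_ifs at hk <;> omega
      have hih := ih hl k (c.erase a) hc' (by rw [hmap]; split_ifs at hk <;> omega)
      obtain ⟨f, hf, g, hg, hfg⟩ := Submodule.mem_sup.mp hih
      rw [hmon, ← hfg, mul_add]
      refine add_mem (Ideal.mem_sup_left ?_) (Ideal.mem_sup_right ?_)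
      · rw [hX, ← Nat.sub_add_cancel hca, pow_add, mul_assoc]
        exact Ideal.mul_mem_left _ _ (X_pow_mul_mem_topEsymmIdeal ha' hf)
      · have hmem := monomial_mul_mem_lexAbove (Finsupp.single a (c a)) hg
        rwa [hsplit] at hmem

lemma topEsymmIdeal_univ_le_Jnk {n k : ℕ} (hkn : k ≤ n) :
    topEsymmIdeal n Finset.univ k ≤ Jnk n k := by
  refine Ideal.span_le.mpr ?_
  rintro _ ⟨j, hj, rfl⟩
  rw [Finset.card_univ, Fintype.card_fin] at hj
  by_cases hjn : j ≤ n
  · exact Ideal.mem_sup_right (Ideal.subset_span ⟨j, by omega, hjn, rfl⟩)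
  · rw [esymmOn_eq_zero (by simpa using hjn)]
    exact zero_mem _

lemma X_pow_mul_topEsymmIdeal_compl_mem_Jnk {n k d : ℕ} (i : Fin n)
    {f : MvPolynomial (Fin n) ℚ} (hf : f ∈ topEsymmIdeal n {i}ᶜ d) :
    MvPolynomial.X i ^ d * f ∈ Jnk n k := by
  refine mul_mem_of_mem_span hf ?_
  rintro _ ⟨j, hj, rfl⟩
  have hcard : ({i}ᶜ : Finset (Fin n)).card = n - 1 := by
    rw [Finset.card_compl, Fintype.card_fin, Finset.card_singleton]
  have hn : 0 < n := i.pos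
  by_cases hjn : j < n
  · refine Ideal.mem_sup_left (Ideal.subset_span ⟨i, n - j, d, by omega, by omega, ?_⟩)
    rw [Nat.sub_sub_self hjn.le]
  · rw [esymmOn_eq_zero (by omega), mul_zero]
    exact zero_mem _

lemma X_pow_mem_Jnk {n k : ℕ} (i : Fin n) : MvPolynomial.X i ^ n ∈ Jnk n k := by
  have hmem := X_pow_mul_topEsymmIdeal_compl_mem_Jnk (k := k) (d := n) i
    (esymmOn_mem_topEsymmIdeal (s := {i}ᶜ) (j := 0) (k := n) (by
      rw [Finset.card_compl, Fintype.card_fin, Finset.card_singleton]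
      have := i.pos
      omega))
  rwa [esymmOn_zero, mul_one] at hmem

theorem monomial_mem_Jnk_sup_lexAbove {n k : ℕ} (hkn : k ≤ n) (c : Fin n →₀ ℕ)
    (h : scan (List.ofFn c) < k ∨ ∃ i, scan (List.ofFn c) < c i) :
    MvPolynomial.monomial c 1 ∈ Jnk n k ⊔ lexAbove c := by
  rw [List.ofFn_eq_map] at h
  rcases h with h | ⟨i, hi⟩
  · have hmem := monomial_mem_topEsymmIdeal_sup_lexAbove (List.finRange n)
      (List.pairwise_lt_finRange n) k c (by simp) h
    rw [List.toFinset_finRange] at hmem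
    exact sup_le_sup_right (topEsymmIdeal_univ_le_Jnk hkn) _ hmem
  · have hmap : ((List.finRange n).filter (· ≠ i)).map (c.erase i) =
        ((List.finRange n).filter (· ≠ i)).map c :=
      List.map_congr_left fun j hj => Finsupp.erase_ne (by simpa using hj)
    have hscan := scan_le_of_sublist
      ((List.filter_sublist (p := (· ≠ i)) (l := List.finRange n)).map c)
    have hmem := monomial_mem_topEsymmIdeal_sup_lexAbove ((List.finRange n).filter (· ≠ i))
      ((List.pairwise_lt_finRange n).filter _) (c i) (c.erase i) (by simp)
      (by rw [hmap]; exact hscan.trans_lt hi)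
    have hset : ((List.finRange n).filter (· ≠ i)).toFinset = {i}ᶜ := by ext; simp
    rw [hset] at hmem
    obtain ⟨f, hf, g, hg, hfg⟩ := Submodule.mem_sup.mp hmem
    have hsplit : Finsupp.single i (c i) + c.erase i = c := Finsupp.single_add_erase i c
    have hmon : (MvPolynomial.monomial c 1 : MvPolynomial (Fin n) ℚ) =
        MvPolynomial.monomial (Finsupp.single i (c i)) 1 *
          MvPolynomial.monomial (c.erase i) 1 := by
      rw [MvPolynomial.monomial_mul, hsplit, one_mul]
    rw [hmon, ← hfg, mul_add]
    refine add_mem (Ideal.mem_sup_left ?_) (Ideal.mem_sup_right ?_)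
    · rw [← MvPolynomial.X_pow_eq_monomial]
      exact X_pow_mul_topEsymmIdeal_compl_mem_Jnk i hf
    · have hmem := monomial_mul_mem_lexAbove (Finsupp.single i (c i)) hg
      rwa [hsplit] at hmem

lemma mem_span_of_monomial_mem {n : ℕ} {T : Submodule ℚ (MvPolynomial (Fin n) ℚ)}
    {f : MvPolynomial (Fin n) ℚ} (h : ∀ b ∈ f.support, MvPolynomial.monomial b 1 ∈ T) :
    f ∈ T := by
  rw [f.as_sum]
  refine sum_mem fun b hb => ?_
  rw [← mul_one (MvPolynomial.coeff b f), ← smul_eq_mul, ← MvPolynomial.smul_monomial]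
  exact T.smul_mem _ (h b hb)

/-- Lexicographically maximal exponents outside `C` are reducible modulo `Jnk n k`, so the
monomials with exponents in `C` span the quotient. -/
theorem span_monomial_sup_Jnk_eq_top {n k : ℕ} (hkn : k ≤ n) {C : Set (Fin n →₀ ℕ)}
    (hC : ∀ c : Fin n →₀ ℕ, k ≤ scan (List.ofFn c) → (∀ i, c i ≤ scan (List.ofFn c)) → c ∈ C) :
    Submodule.span ℚ ((fun c => MvPolynomial.monomial c 1) '' C) ⊔
      (Jnk n k).restrictScalars ℚ = ⊤ := by
  set T := Submodule.span ℚ ((fun c => MvPolynomial.monomial c (1 : ℚ)) '' C) ⊔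
    (Jnk n k).restrictScalars ℚ with hT
  have hJT : ∀ f ∈ Jnk n k, f ∈ T := fun f hf => Submodule.mem_sup_right hf
  have hmon : ∀ c : Fin n →₀ ℕ, MvPolynomial.monomial c 1 ∈ T := by
    by_contra! hne
    obtain ⟨c₀, hc₀⟩ := hne
    have hbox : ∀ c : Fin n →₀ ℕ, MvPolynomial.monomial c 1 ∉ T → ∀ i, c i < n := by
      intro c hc i
      by_contra! hci
      refine hc (hJT _ ?_)
      have hsplit : (MvPolynomial.monomial c 1 : MvPolynomial (Fin n) ℚ) =
          MvPolynomial.monomial (c - Finsupp.single i n) 1 * MvPolynomial.X i ^ n := by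
        rw [MvPolynomial.X_pow_eq_monomial, MvPolynomial.monomial_mul, one_mul,
          tsub_add_cancel_of_le (Finsupp.single_le_iff.mpr hci)]
      rw [hsplit]
      exact Ideal.mul_mem_left _ _ (X_pow_mem_Jnk i)
    have hfin : {a : Lex (Fin n → ℕ) | ∃ c : Fin n →₀ ℕ, a = toLex ⇑c ∧
        MvPolynomial.monomial c 1 ∉ T}.Finite := by
      refine ((Set.Finite.pi' fun _ : Fin n => Set.finite_Iio n).image toLex).subset ?_
      rintro _ ⟨c, rfl, hc⟩
      exact ⟨c, fun i => hbox c hc i, rfl⟩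
    obtain ⟨_, ⟨c, rfl, hc⟩, hmax⟩ := hfin.exists_maximal ⟨_, c₀, rfl, hc₀⟩
    have habove : ∀ f ∈ lexAbove c, f ∈ T := fun f hf => mem_span_of_monomial_mem fun b hb => by
      by_contra hbT
      have hlt := mem_lexAbove.mp hf b hb
      exact not_le_of_gt hlt (hmax ⟨b, rfl, hbT⟩ hlt.le)
    refine hc ?_
    by_cases hred : scan (List.ofFn c) < k ∨ ∃ i, scan (List.ofFn c) < c i
    · obtain ⟨f, hf, g, hg, hfg⟩ :=
        Submodule.mem_sup.mp (monomial_mem_Jnk_sup_lexAbove hkn c hred)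
      rw [← hfg]
      exact add_mem (hJT f hf) (habove g hg)
    · push Not at hred
      exact Submodule.mem_sup_left (Submodule.subset_span ⟨c, hC c hred.1 hred.2, rfl⟩)
  exact eq_top_iff.mpr fun f _ => mem_span_of_monomial_mem fun b _ => hmon b

lemma exists_card_filter_gt {α : Type*} [LinearOrder α] {E : Finset α} {r : ℕ} (hr : r < E.card) :
    ∃ j ∈ E, (E.filter (j < ·)).card = r := by
  have hcard : (Finset.univ.filter
      (⟨E.card - 1 - r, by omega⟩ < · : Fin E.card → Prop)).card = r := by
    rw [Finset.filter_lt_eq_Ioi, Fin.card_Ioi]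
    simp only
    omega
  refine ⟨E.orderEmbOfFin rfl ⟨E.card - 1 - r, by omega⟩, E.orderEmbOfFin_mem rfl _,
    Eq.trans ?_ hcard⟩
  rw [← Finset.card_map (E.orderEmbOfFin rfl).toEmbedding]
  congr 1
  ext x
  simp only [Finset.mem_filter, Finset.mem_map, Finset.mem_univ, true_and]
  constructor
  · rintro ⟨hx, hlt⟩
    obtain ⟨y, rfl⟩ : x ∈ Set.range (E.orderEmbOfFin rfl) := by
      rw [Finset.range_orderEmbOfFin]; exact hx
    exact ⟨y, by simpa using hlt, rfl⟩
  · rintro ⟨y, hy, rfl⟩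
    exact ⟨E.orderEmbOfFin_mem rfl _, by simpa using hy⟩

lemma exists_notMem_card_filter_gt {m : ℕ} {E : Finset (Fin m)} {c : ℕ} (hE : E.card < c)
    (hc : c ≤ m) : ∃ j ∉ E, (E.filter (j < ·)).card + (j + 1) = c := by
  have hcompl : Eᶜ.card = m - E.card := by rw [Finset.card_compl, Fintype.card_fin]
  obtain ⟨j, hj, hcard⟩ := exists_card_filter_gt (E := Eᶜ) (r := m - c) (by omega)
  refine ⟨j, by simpa using hj, ?_⟩
  have hsum : (E.filter (j < ·)).card + (Eᶜ.filter (j < ·)).card = m - 1 - j := by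
    rw [← Finset.card_union_of_disjoint
      (Finset.disjoint_filter_filter disjoint_compl_right), ← Finset.filter_union,
      Finset.union_compl, Finset.filter_lt_eq_Ioi, Fin.card_Ioi]
  have := j.isLt
  omega

/-- The insertion algorithm: letters are placed from left to right into `m` blocks, of which
those in `E` are initially empty, so that the code entries are those of `l`. -/
lemma exists_blockIndex {m : ℕ} (hm : 0 < m) (l : List ℕ) : ∀ E : Finset (Fin m), E.card = scan l →
    (∀ c ∈ l, c ≤ m) → ∃ w : ℕ → Fin m, E ⊆ (Finset.range l.length).image w ∧
      ∀ (p : ℕ) (hp : p < l.length),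
        ((E \ (Finset.range p).image w).filter (w p < ·)).card +
          (if w p ∈ E \ (Finset.range p).image w then 0 else (w p : ℕ) + 1) = l[p] := by
  induction l with
  | nil =>
    intro E hE _
    have hE0 : E = ∅ := Finset.card_eq_zero.mp hE
    exact ⟨fun _ => ⟨0, hm⟩, by simp [hE0], by simp⟩
  | cons c l ih =>
    intro E hE hl
    have hcm : c ≤ m := hl c (by simp)
    obtain ⟨j, hj, hjE⟩ : ∃ j : Fin m, (E.filter (j < ·)).card +
        (if j ∈ E then 0 else (j : ℕ) + 1) = c ∧ (E.erase j).card = scan l := by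
      simp only [scan] at hE
      split_ifs at hE with h
      · obtain ⟨j, hj, hcard⟩ := exists_card_filter_gt (E := E) (r := c) (by omega)
        exact ⟨j, by simp [hj, hcard], by rw [Finset.card_erase_of_mem hj]; omega⟩
      · obtain ⟨j, hj, hcard⟩ := exists_notMem_card_filter_gt (E := E) (c := c) (by omega) hcm
        exact ⟨j, by simp [hj, hcard], by rw [Finset.erase_eq_of_notMem hj, hE]⟩
    obtain ⟨w, hw, hcode⟩ := ih (E.erase j) hjE fun c hc => hl c (by simp [hc])
    set w' : ℕ → Fin m := fun p => Nat.casesOn p j w with hw'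
    have himage : ∀ p, (Finset.range (p + 1)).image w' = insert j ((Finset.range p).image w) := by
      intro p
      rw [Finset.range_add_one', Finset.image_insert, Finset.map_eq_image, Finset.image_image]
      rfl
    refine ⟨w', ?_, ?_⟩
    · rw [List.length_cons, himage]
      intro x hx
      by_cases hxj : x = j
      · simp [hxj]
      · exact Finset.mem_insert_of_mem (hw (Finset.mem_erase.mpr ⟨hxj, hx⟩))
    · rintro (_ | p) hp
      · simpa [hw'] using hj
      · have hsdiff : E \ (Finset.range (p + 1)).image w' =
            E.erase j \ (Finset.range p).image w := by
          rw [himage]; ext x; simp; tauto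
        rw [hsdiff]
        exact hcode p (by simpa using hp)

lemma OSP.eq_of_mem {n m : ℕ} (σ : OSP n m) {x : ℕ} {i j : Fin m} (hi : x ∈ σ.blocks i)
    (hj : x ∈ σ.blocks j) : i = j := by
  by_contra hij
  exact Finset.disjoint_left.mp (σ.blocks_disjoint i j hij) hi hj

lemma bcode_eq {n m : ℕ} (σ : OSP n m) {p : Fin n} {j : Fin m}
    (hj : (p : ℕ) + 1 ∈ σ.blocks j) :
    bcode σ p = (Finset.univ.filter fun ℓ : Fin m =>
        j < ℓ ∧ ∀ x ∈ σ.blocks ℓ, (p : ℕ) + 1 < x).card +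
      (if ∀ x ∈ σ.blocks j, (p : ℕ) + 1 ≤ x then 0 else (j : ℕ) + 1) := by
  have h : ∃ j, (p : ℕ) + 1 ∈ σ.blocks j := ⟨j, hj⟩
  have hch : h.choose = j := σ.eq_of_mem h.choose_spec hj
  rw [bcode, codeAux, dif_pos h, hch]

theorem exists_bcode_eq {n : ℕ} (c : Fin n → ℕ) (hpos : 0 < scan (List.ofFn c))
    (hc : ∀ i, c i ≤ scan (List.ofFn c)) :
    ∃ σ : OSP n (scan (List.ofFn c)), bcode σ = c := by
  set m := scan (List.ofFn c) with hm
  obtain ⟨w, hw, hcode⟩ := exists_blockIndex hpos (List.ofFn c) (Finset.univ : Finset (Fin m))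
    (by simp [hm]) (by simpa [List.mem_ofFn'] using hc)
  rw [List.length_ofFn] at hw
  let σ : OSP n m :=
    { blocks := fun j => ((Finset.range n).filter (w · = j)).image (· + 1)
      subset_range := fun j x hx => by
        simp only [Finset.mem_image, Finset.mem_filter, Finset.mem_range] at hx
        obtain ⟨p, ⟨hp, -⟩, rfl⟩ := hx
        simpa using hp
      blocks_nonempty := fun j => by
        obtain ⟨p, hp, hpj⟩ := Finset.mem_image.mp (hw (Finset.mem_univ j))
        exact ⟨p + 1, Finset.mem_image_of_mem _ (Finset.mem_filter.mpr ⟨hp, hpj⟩)⟩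
      blocks_disjoint := fun i j hij => by
        rw [Finset.disjoint_left]
        simp only [Finset.mem_image, Finset.mem_filter]
        rintro _ ⟨p, ⟨-, hp⟩, rfl⟩ ⟨q, ⟨-, hq⟩, hpq⟩
        exact hij (by rw [← hp, ← hq, Nat.succ_injective hpq])
      cover := fun i hi => by
        rw [Finset.mem_Icc] at hi
        refine ⟨w (i - 1), Finset.mem_image.mpr ⟨i - 1, ?_, by omega⟩⟩
        simp only [Finset.mem_filter, Finset.mem_range, and_true]
        omega }
  have hmem : ∀ {x : ℕ} {j : Fin m}, x ∈ σ.blocks j ↔ ∃ q, q < n ∧ w q = j ∧ q + 1 = x := by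
    intro x j
    simp [σ, and_assoc]
  refine ⟨σ, funext fun p => ?_⟩
  have hp : (p : ℕ) + 1 ∈ σ.blocks (w p) := hmem.mpr ⟨p, p.isLt, rfl, rfl⟩
  have hval := hcode p (by simp)
  rw [List.getElem_ofFn] at hval
  rw [bcode_eq σ hp, ← hval]
  congr 1
  · congr 1
    ext ℓ
    simp only [Finset.mem_filter, Finset.mem_univ, true_and, Finset.mem_sdiff, Finset.mem_image,
      Finset.mem_range, not_exists, not_and]
    constructor
    · rintro ⟨hlt, hall⟩
      refine ⟨fun q hq hqℓ => ?_, hlt⟩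
      have := hall (q + 1) (hmem.mpr ⟨q, hq.trans p.isLt, hqℓ, rfl⟩)
      omega
    · rintro ⟨hall, hlt⟩
      refine ⟨hlt, fun x hx => ?_⟩
      obtain ⟨q, -, hqℓ, rfl⟩ := hmem.mp hx
      have h1 : ¬ q < p := fun h => hall q h hqℓ
      have h2 : q ≠ p := fun h => hlt.ne (by rw [← hqℓ, h])
      omega
  · refine if_congr ?_ rfl rfl
    simp only [Finset.mem_univ, true_and, Finset.mem_sdiff, Finset.mem_image,
      Finset.mem_range, not_exists, not_and]
    constructor
    · intro hall q hq hqp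
      have := hall (q + 1) (hmem.mpr ⟨q, hq.trans p.isLt, hqp, rfl⟩)
      omega
    · intro hall x hx
      obtain ⟨q, -, hqp, rfl⟩ := hmem.mp hx
      have : ¬ q < p := fun h => hall q h hqp
      omega

/-- The polynomials of total degree less than `d`. -/
def degreeLTSubmodule (n d : ℕ) : Submodule ℚ (MvPolynomial (Fin n) ℚ) where
  carrier := {f | ∀ m, d ≤ m.degree → MvPolynomial.coeff m f = 0}
  zero_mem' := fun m _ => MvPolynomial.coeff_zero m
  add_mem' := fun hf hg m hm => by rw [MvPolynomial.coeff_add, hf m hm, hg m hm, add_zero]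
  smul_mem' := fun r f hf m hm => by rw [MvPolynomial.coeff_smul, hf m hm, smul_zero]

lemma degreeLTSubmodule_mono {n d e : ℕ} (h : d ≤ e) :
    degreeLTSubmodule n d ≤ degreeLTSubmodule n e :=
  fun _ hf m hm => hf m (h.trans hm)

lemma mul_mem_degreeLTSubmodule {n d e : ℕ} {f g : MvPolynomial (Fin n) ℚ}
    (hf : f ∈ degreeLTSubmodule n d) (hg : g ∈ degreeLTSubmodule n (e + 1)) :
    f * g ∈ degreeLTSubmodule n (d + e) := by
  intro m hm
  rw [MvPolynomial.coeff_mul]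
  refine Finset.sum_eq_zero fun u hu => ?_
  have hum : u.1 + u.2 = m := by simpa using hu
  rw [← hum, map_add] at hm
  by_cases h : d ≤ u.1.degree
  · rw [hf _ h, zero_mul]
  · rw [hg _ (by omega), mul_zero]

lemma mem_degreeLTSubmodule_of_isHomogeneous {n d e : ℕ} {f : MvPolynomial (Fin n) ℚ}
    (hf : f.IsHomogeneous d) (h : d < e) : f ∈ degreeLTSubmodule n e :=
  fun m hm => hf.coeff_eq_zero (by omega)

lemma mul_sub_mul_mem_degreeLTSubmodule {n d e : ℕ} {f₁ f₂ g₁ g₂ : MvPolynomial (Fin n) ℚ}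
    (hf₁ : f₁.IsHomogeneous d) (hf₂ : f₂.IsHomogeneous e)
    (h₁ : g₁ - f₁ ∈ degreeLTSubmodule n d) (h₂ : g₂ - f₂ ∈ degreeLTSubmodule n e) :
    g₁ * g₂ - f₁ * f₂ ∈ degreeLTSubmodule n (d + e) := by
  have hg₂ : g₂ ∈ degreeLTSubmodule n (e + 1) := by
    have := add_mem (degreeLTSubmodule_mono e.le_succ h₂)
      (mem_degreeLTSubmodule_of_isHomogeneous hf₂ e.lt_succ_self)
    rwa [sub_add_cancel] at this
  have h : g₁ * g₂ - f₁ * f₂ = (g₁ - f₁) * g₂ + (g₂ - f₂) * f₁ := by ring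
  rw [h]
  refine add_mem (mul_mem_degreeLTSubmodule h₁ hg₂) ?_
  rw [add_comm d e]
  exact mul_mem_degreeLTSubmodule h₂ (mem_degreeLTSubmodule_of_isHomogeneous hf₁ d.lt_succ_self)

/-- The polynomials each of whose homogeneous components is the leading form of an element
of `V`, or zero. -/
def leadingFormIdeal {n : ℕ} (V : Ideal (MvPolynomial (Fin n) ℚ)) :
    Ideal (MvPolynomial (Fin n) ℚ) where
  carrier := {f | ∀ d, ∃ g ∈ V, ∀ m, d ≤ m.degree →
    MvPolynomial.coeff m g = if m.degree = d then MvPolynomial.coeff m f else 0}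
  zero_mem' := fun d => ⟨0, V.zero_mem, by simp⟩
  add_mem' := fun {f₁ f₂} h₁ h₂ d => by
    obtain ⟨g₁, hg₁, hc₁⟩ := h₁ d
    obtain ⟨g₂, hg₂, hc₂⟩ := h₂ d
    refine ⟨g₁ + g₂, V.add_mem hg₁ hg₂, fun m hm => ?_⟩
    rw [MvPolynomial.coeff_add, hc₁ m hm, hc₂ m hm, MvPolynomial.coeff_add]
    split_ifs <;> simp
  smul_mem' := fun r f hf => by
    rw [smul_eq_mul]
    induction r using MvPolynomial.induction_on with
    | C a =>
      intro d
      obtain ⟨g, hg, hc⟩ := hf d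
      refine ⟨MvPolynomial.C a * g, V.mul_mem_left _ hg, fun m hm => ?_⟩
      rw [MvPolynomial.coeff_C_mul, MvPolynomial.coeff_C_mul, hc m hm]
      split_ifs <;> simp
    | add p q hp hq =>
      intro d
      obtain ⟨g₁, hg₁, hc₁⟩ := hp d
      obtain ⟨g₂, hg₂, hc₂⟩ := hq d
      refine ⟨g₁ + g₂, V.add_mem hg₁ hg₂, fun m hm => ?_⟩
      rw [MvPolynomial.coeff_add, hc₁ m hm, hc₂ m hm, add_mul, MvPolynomial.coeff_add]
      split_ifs <;> simp
    | mul_X p i hp =>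
      intro d
      have hcomm : p * MvPolynomial.X i * f = MvPolynomial.X i * (p * f) := by ring
      rw [hcomm]
      have hdeg : ∀ m : Fin n →₀ ℕ, i ∈ m.support →
          (m - Finsupp.single i 1).degree + 1 = m.degree := fun m hm => by
        have hle : Finsupp.single i 1 ≤ m :=
          Finsupp.single_le_iff.mpr (Nat.one_le_iff_ne_zero.mpr (Finsupp.mem_support_iff.mp hm))
        conv_rhs => rw [← tsub_add_cancel_of_le hle, map_add, Finsupp.degree_single]
      cases d with
      | zero =>
        refine ⟨0, V.zero_mem, fun m _ => ?_⟩
        rw [MvPolynomial.coeff_zero, MvPolynomial.coeff_X_mul']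
        split_ifs with h₁ h₂
        · have := hdeg m h₂
          omega
        · rfl
        · rfl
      | succ d =>
        obtain ⟨g, hg, hc⟩ := hp d
        refine ⟨MvPolynomial.X i * g, V.mul_mem_left _ hg, fun m hm => ?_⟩
        rw [MvPolynomial.coeff_X_mul', MvPolynomial.coeff_X_mul']
        by_cases him : i ∈ m.support
        · have := hdeg m him
          rw [if_pos him, if_pos him, hc _ (by omega)]
          exact if_congr (by omega) rfl rfl
        · simp [him]

lemma mem_leadingFormIdeal_of_sub_mem {n d : ℕ} {V : Ideal (MvPolynomial (Fin n) ℚ)}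
    {f g : MvPolynomial (Fin n) ℚ} (hf : f.IsHomogeneous d) (hg : g ∈ V)
    (h : g - f ∈ degreeLTSubmodule n d) : f ∈ leadingFormIdeal V := by
  intro e
  by_cases hed : e = d
  · subst hed
    refine ⟨g, hg, fun m hm => ?_⟩
    have hgf := h m hm
    rw [MvPolynomial.coeff_sub, sub_eq_zero] at hgf
    rw [hgf]
    split_ifs with hme
    · rfl
    · exact hf.coeff_eq_zero hme
  · refine ⟨0, V.zero_mem, fun m _ => ?_⟩
    rw [MvPolynomial.coeff_zero]
    split_ifs with hme
    · exact (hf.coeff_eq_zero (by omega)).symm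
    · rfl

lemma homogeneousComponent_mem_span_monomial {n : ℕ} {C : Set (Fin n →₀ ℕ)} (d : ℕ)
    {f : MvPolynomial (Fin n) ℚ}
    (hf : f ∈ Submodule.span ℚ ((fun c => MvPolynomial.monomial c (1 : ℚ)) '' C)) :
    MvPolynomial.homogeneousComponent d f ∈
      Submodule.span ℚ ((fun c => MvPolynomial.monomial c (1 : ℚ)) '' C) := by
  induction hf using Submodule.span_induction with
  | mem g hg =>
    obtain ⟨c, hc, rfl⟩ := hg
    rw [MvPolynomial.homogeneousComponent_of_mem
      ((MvPolynomial.mem_homogeneousSubmodule _ _).mpr (MvPolynomial.isHomogeneous_monomial _ rfl))]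
    split_ifs
    · exact Submodule.subset_span ⟨c, hc, rfl⟩
    · exact zero_mem _
  | zero => simp
  | add f g _ _ hf hg => rw [map_add]; exact add_mem hf hg
  | smul r f _ hf => rw [map_smul]; exact Submodule.smul_mem _ r hf

/-- Monomials that span modulo an ideal of leading forms of `V` also span modulo `V`. -/
theorem span_monomial_sup_eq_top_of_le_leadingFormIdeal {n : ℕ} {C : Set (Fin n →₀ ℕ)}
    {J V : Ideal (MvPolynomial (Fin n) ℚ)} (hJ : J ≤ leadingFormIdeal V)
    (hspan : Submodule.span ℚ ((fun c => MvPolynomial.monomial c (1 : ℚ)) '' C) ⊔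
      J.restrictScalars ℚ = ⊤) :
    Submodule.span ℚ ((fun c => MvPolynomial.monomial c (1 : ℚ)) '' C) ⊔
      V.restrictScalars ℚ = ⊤ := by
  have hdeg : ∀ d, ∀ f ∈ degreeLTSubmodule n d,
      f ∈ Submodule.span ℚ ((fun c => MvPolynomial.monomial c (1 : ℚ)) '' C) ⊔
        V.restrictScalars ℚ := by
    intro d
    induction d with
    | zero =>
      intro f hf
      have hf0 : f = 0 := MvPolynomial.ext _ _ fun m => hf m (Nat.zero_le _)
      rw [hf0]
      exact zero_mem _
    | succ d ih =>
      intro f hf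
      obtain ⟨a, ha, j, hj, hfaj⟩ := Submodule.mem_sup.mp
        (hspan.symm ▸ Submodule.mem_top : f ∈ Submodule.span ℚ
          ((fun c => MvPolynomial.monomial c (1 : ℚ)) '' C) ⊔ J.restrictScalars ℚ)
      obtain ⟨g, hg, hc⟩ := hJ hj d
      have hlow : f - (MvPolynomial.homogeneousComponent d a + g) ∈ degreeLTSubmodule n d := by
        intro m hm
        rw [MvPolynomial.coeff_sub, MvPolynomial.coeff_add, hc m hm,
          MvPolynomial.coeff_homogeneousComponent]
        split_ifs with hmd
        · rw [← hfaj, MvPolynomial.coeff_add, sub_self]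
        · rw [hf m (by omega), add_zero, sub_zero]
      have hsum := add_mem (ih _ hlow) (add_mem
        (Submodule.mem_sup_left (homogeneousComponent_mem_span_monomial d ha))
        (Submodule.mem_sup_right hg))
      rwa [sub_add_cancel] at hsum
  refine eq_top_iff.mpr fun f _ => hdeg (f.totalDegree + 1) f fun m hm => ?_
  refine MvPolynomial.coeff_eq_zero_of_totalDegree_lt ?_
  have : m.degree = ∑ i ∈ m.support, m i := rfl
  omega

/-- Evaluation of polynomials at a family of points. -/
noncomputable def evalAt {n : ℕ} {ι : Type*} (x : ι → Fin n → ℚ) :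
    MvPolynomial (Fin n) ℚ →+* (ι → ℚ) :=
  RingHom.pi fun i => MvPolynomial.eval (x i)

lemma evalAt_apply {n : ℕ} {ι : Type*} (x : ι → Fin n → ℚ) (f : MvPolynomial (Fin n) ℚ) (i : ι) :
    evalAt x f i = MvPolynomial.eval (x i) f := rfl

lemma evalAt_surjective {n : ℕ} {ι : Type*} [Finite ι] {x : ι → Fin n → ℚ}
    (hx : Function.Injective x) : Function.Surjective (evalAt x) := by
  classical
  have := Fintype.ofFinite ι
  have hsep : ∀ i j, ∃ q : MvPolynomial (Fin n) ℚ, i ≠ j →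
      MvPolynomial.eval (x i) q = 1 ∧ MvPolynomial.eval (x j) q = 0 := by
    intro i j
    by_cases hij : i = j
    · exact ⟨0, fun h => absurd hij h⟩
    obtain ⟨p, hp⟩ := Function.ne_iff.mp (hx.ne hij)
    refine ⟨MvPolynomial.C (x i p - x j p)⁻¹ * (MvPolynomial.X p - MvPolynomial.C (x j p)),
      fun _ => ⟨?_, ?_⟩⟩
    · simp [inv_mul_cancel₀ (sub_ne_zero.mpr hp)]
    · simp
  choose q hq using hsep
  intro y
  refine ⟨∑ i, MvPolynomial.C (y i) * ∏ j ∈ Finset.univ.erase i, q i j, funext fun l => ?_⟩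
  simp only [evalAt_apply, map_sum, map_mul, map_prod, MvPolynomial.eval_C]
  rw [Finset.sum_eq_single l]
  · rw [Finset.prod_eq_one fun j hj => (hq l j (Finset.ne_of_mem_erase hj).symm).1, mul_one]
  · intro i _ hil
    rw [Finset.prod_eq_zero (Finset.mem_erase.mpr ⟨hil.symm, Finset.mem_univ l⟩) (hq i l hil).2,
      mul_zero]
  · simp

theorem card_le_card_of_span_monomial_sup_eq_top {n : ℕ} {ι κ : Type*} [Fintype ι] [Fintype κ]
    {x : ι → Fin n → ℚ} (hx : Function.Injective x) {J : Ideal (MvPolynomial (Fin n) ℚ)}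
    (hJ : J ≤ leadingFormIdeal (RingHom.ker (evalAt x))) (c : κ → Fin n →₀ ℕ)
    (hspan : Submodule.span ℚ (Set.range fun i => MvPolynomial.monomial (c i) (1 : ℚ)) ⊔
      J.restrictScalars ℚ = ⊤) : Fintype.card ι ≤ Fintype.card κ := by
  have hrange : Set.range (fun i => MvPolynomial.monomial (c i) (1 : ℚ)) =
      (fun c => MvPolynomial.monomial c (1 : ℚ)) '' Set.range c := by
    rw [← Set.range_comp]; rfl
  rw [hrange] at hspan
  have htop := span_monomial_sup_eq_top_of_le_leadingFormIdeal hJ hspan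
  rw [← hrange] at htop
  let φ : MvPolynomial (Fin n) ℚ →ₗ[ℚ] (ι → ℚ) :=
    { evalAt x with
      map_smul' := fun r f => funext fun i => by simp [evalAt_apply] }
  have hφ : LinearMap.range φ = ⊤ := LinearMap.range_eq_top.mpr (evalAt_surjective hx)
  have hker : LinearMap.ker φ = (RingHom.ker (evalAt x)).restrictScalars ℚ := by
    ext f; rfl
  rw [← hker, ← LinearMap.map_eq_top_iff hφ, Submodule.map_span, ← Set.range_comp] at htop
  simpa using finrank_le_of_span_eq_top htop

lemma esymmOn_isHomogeneous {n : ℕ} (s : Finset (Fin n)) (j : ℕ) :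
    (esymmOn n s j).IsHomogeneous j := by
  refine MvPolynomial.IsHomogeneous.sum _ _ _ fun t ht => ?_
  have h := MvPolynomial.IsHomogeneous.prod t (fun i => (MvPolynomial.X i : MvPolynomial (Fin n) ℚ))
    (fun _ => 1) fun i _ => MvPolynomial.isHomogeneous_X ℚ i
  simpa [(Finset.mem_powersetCard.mp ht).2] using h

lemma coeff_prod_X_sub_C {n : ℕ} (s : Finset (Fin n)) {m : ℕ} (hm : m ≤ s.card) :
    (∏ i ∈ s, (Polynomial.X - Polynomial.C (MvPolynomial.X i : MvPolynomial (Fin n) ℚ))).coeff m =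
      (-1) ^ (s.card - m) * esymmOn n s (s.card - m) := by
  have h := Multiset.prod_X_sub_C_coeff
    (s.val.map fun i => (MvPolynomial.X i : MvPolynomial (Fin n) ℚ)) (k := m) (by simpa using hm)
  rw [Finset.esymm_map_val, Multiset.map_map, Multiset.card_map] at h
  exact h

/-- A polynomial with leading form `esymmOn n s j` that vanishes at all points whose coordinates
indexed by `s` include `0, …, d - 1`: a coefficient of the remainder of `∏ (T - x_i)` modulo
`∏ (T - a)`. -/
theorem exists_esymmOn_lift {n : ℕ} (s : Finset (Fin n)) {j d : ℕ} (h : s.card < j + d) :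
    ∃ g : MvPolynomial (Fin n) ℚ, g - esymmOn n s j ∈ degreeLTSubmodule n j ∧
      ∀ x : Fin n → ℚ, (∀ a < d, ∃ i ∈ s, x i = a) → MvPolynomial.eval x g = 0 := by
  by_cases hjs : s.card < j
  · exact ⟨0, by simp [esymmOn_eq_zero hjs], by simp⟩
  push Not at hjs
  set A : Polynomial ℚ := ∏ a ∈ Finset.range d, (Polynomial.X - Polynomial.C (a : ℚ)) with hA
  have hAm : A.Monic := Polynomial.monic_prod_of_monic _ _ fun a _ => Polynomial.monic_X_sub_C _
  have hAdeg : A.natDegree = d := by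
    rw [hA, Polynomial.natDegree_prod_of_monic _ _ fun a _ => Polynomial.monic_X_sub_C _]
    simp only [Polynomial.natDegree_X_sub_C, Finset.sum_const, Finset.card_range, smul_eq_mul,
      mul_one]
  set A' : Polynomial (MvPolynomial (Fin n) ℚ) := A.map MvPolynomial.C with hA'
  set P : Polynomial (MvPolynomial (Fin n) ℚ) :=
    ∏ i ∈ s, (Polynomial.X - Polynomial.C (MvPolynomial.X i)) with hP
  have hA'm : A'.Monic := hAm.map _
  set l := s.card - j with hl
  refine ⟨(-1) ^ j * (P %ₘ A').coeff l, ?_, ?_⟩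
  · have hPdeg : P.natDegree < s.card + 1 := by
      rw [hP, Polynomial.natDegree_prod_of_monic _ _ fun i _ => Polynomial.monic_X_sub_C _]
      simp
    have hcoeff : (P %ₘ A').coeff l = ∑ m ∈ Finset.range (s.card + 1),
        P.coeff m * MvPolynomial.C ((Polynomial.X ^ m %ₘ A).coeff l) := by
      have hmod : P %ₘ A' = ∑ m ∈ Finset.range (s.card + 1),
          P.coeff m • (Polynomial.X ^ m %ₘ A') := by
        conv_lhs => rw [P.as_sum_range' _ hPdeg]
        rw [← Polynomial.modByMonicHom_apply, map_sum]
        refine Finset.sum_congr rfl fun m _ => ?_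
        rw [Polynomial.modByMonicHom_apply, ← Polynomial.smul_modByMonic,
          Polynomial.smul_X_eq_monomial]
      rw [hmod, Polynomial.finsetSum_coeff]
      refine Finset.sum_congr rfl fun m _ => ?_
      rw [Polynomial.coeff_smul, smul_eq_mul, ← Polynomial.coeff_map,
        Polynomial.map_modByMonic _ hAm, Polynomial.map_pow, Polynomial.map_X]
    have hsmall : ∀ m < d, (Polynomial.X ^ m %ₘ A).coeff l = if l = m then 1 else 0 := by
      intro m hm
      rw [(Polynomial.modByMonic_eq_self_iff hAm).mpr, Polynomial.coeff_X_pow]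
      rw [Polynomial.degree_X_pow, Polynomial.degree_eq_natDegree hAm.ne_zero, hAdeg]
      exact_mod_cast hm
    have hlmem : l ∈ Finset.range (s.card + 1) := Finset.mem_range.mpr (by omega)
    rw [hcoeff, ← Finset.add_sum_erase _ _ hlmem, hsmall l (by omega), if_pos rfl, map_one,
      mul_one, hP, coeff_prod_X_sub_C s (by omega), Nat.sub_sub_self hjs, mul_add, ← mul_assoc,
      ← mul_pow, neg_one_mul, neg_neg, one_pow, one_mul, add_sub_cancel_left, Finset.mul_sum]
    refine sum_mem fun m hm => ?_
    obtain ⟨hml, hm⟩ := Finset.mem_erase.mp hm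
    have hms : m ≤ s.card := by simpa [Nat.lt_succ_iff] using hm
    by_cases hmd : m < d
    · rw [hsmall m hmd, if_neg hml.symm, map_zero, mul_zero, mul_zero]
      exact zero_mem _
    · rw [coeff_prod_X_sub_C s hms]
      have hmem : esymmOn n s (s.card - m) ∈ degreeLTSubmodule n j :=
        mem_degreeLTSubmodule_of_isHomogeneous (esymmOn_isHomogeneous s _) (by omega)
      have hsm := Submodule.smul_mem _ ((-1) ^ j * (-1) ^ (s.card - m) *
        (Polynomial.X ^ m %ₘ A).coeff l) hmem
      rw [MvPolynomial.smul_eq_C_mul] at hsm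
      convert hsm using 1
      simp only [map_mul, map_pow, map_neg, map_one]
      ring
  · intro x hx
    have hdvd : A ∣ P.map (MvPolynomial.eval x) := by
      refine Finset.prod_dvd_of_coprime (fun a _ b _ hab =>
        Polynomial.pairwise_coprime_X_sub_C (Nat.cast_injective (R := ℚ)) hab) fun a ha => ?_
      obtain ⟨i, hi, hia⟩ := hx a (Finset.mem_range.mp ha)
      rw [hP, Polynomial.map_prod, ← hia]
      refine dvd_trans (dvd_of_eq ?_) (Finset.dvd_prod_of_mem _ hi)
      simp
    have hAx : A'.map (MvPolynomial.eval x) = A := by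
      have hid : (MvPolynomial.eval x).comp MvPolynomial.C = RingHom.id ℚ :=
        RingHom.ext fun a => MvPolynomial.eval_C a
      rw [hA', Polynomial.map_map, hid, Polynomial.map_id]
    rw [map_mul, ← Polynomial.coeff_map, Polynomial.map_modByMonic _ hA'm, hAx,
      (Polynomial.modByMonic_eq_zero_iff_dvd hAm).mpr hdvd, Polynomial.coeff_zero, mul_zero]

lemma prod_X_sub_C_sub_pow_mem {n : ℕ} (i : Fin n) (d : ℕ) :
    (∏ a ∈ Finset.range d, (MvPolynomial.X i - MvPolynomial.C (a : ℚ))) - MvPolynomial.X i ^ d ∈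
      degreeLTSubmodule n d := by
  induction d with
  | zero => simp
  | succ d ih =>
    rw [Finset.prod_range_succ, pow_succ]
    refine mul_sub_mul_mem_degreeLTSubmodule (MvPolynomial.isHomogeneous_X_pow i d)
      (MvPolynomial.isHomogeneous_X ℚ i) ih ?_
    rw [sub_sub_cancel_left]
    exact neg_mem (mem_degreeLTSubmodule_of_isHomogeneous (MvPolynomial.isHomogeneous_C _ _)
      Nat.zero_lt_one)

theorem Jnk_le_leadingFormIdeal {n k : ℕ} {ι : Type*} {w : ι → Fin n → ℕ}
    (hlt : ∀ i, ∀ a < k, ∃ p, w i p = a) (hpacked : ∀ i p, ∀ a < w i p, ∃ q, w i q = a) :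
    Jnk n k ≤ leadingFormIdeal (RingHom.ker (evalAt fun i p => (w i p : ℚ))) := by
  have hker : ∀ {g : MvPolynomial (Fin n) ℚ},
      (∀ i, MvPolynomial.eval (fun p => (w i p : ℚ)) g = 0) →
        g ∈ RingHom.ker (evalAt fun i p => (w i p : ℚ)) := fun h => funext h
  refine sup_le (Ideal.span_le.mpr ?_) (Ideal.span_le.mpr ?_)
  · rintro _ ⟨p, r, d, hr, hrd, rfl⟩
    have hn := p.pos
    obtain ⟨g, hg, hvan⟩ := exists_esymmOn_lift ({p}ᶜ : Finset (Fin n)) (j := n - r) (d := d) (by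
      rw [Finset.card_compl, Fintype.card_fin, Finset.card_singleton]
      omega)
    refine mem_leadingFormIdeal_of_sub_mem
      ((MvPolynomial.isHomogeneous_X_pow p d).mul (esymmOn_isHomogeneous _ _))
      (hker fun i => ?_) (mul_sub_mul_mem_degreeLTSubmodule (MvPolynomial.isHomogeneous_X_pow p d)
        (esymmOn_isHomogeneous _ _) (prod_X_sub_C_sub_pow_mem p d) hg)
    rw [map_mul]
    by_cases hpd : w i p < d
    · rw [map_prod, Finset.prod_eq_zero (Finset.mem_range.mpr hpd) (by simp), zero_mul]
    · rw [hvan, mul_zero]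
      intro a ha
      obtain ⟨q, rfl⟩ := hpacked i p a (by omega)
      refine ⟨q, ?_, rfl⟩
      rw [Finset.mem_compl, Finset.mem_singleton]
      rintro rfl
      exact hpd ha
  · rintro _ ⟨j, hj, hjn, rfl⟩
    obtain ⟨g, hg, hvan⟩ := exists_esymmOn_lift (Finset.univ : Finset (Fin n)) (j := j) (d := k)
      (by rw [Finset.card_univ, Fintype.card_fin]; omega)
    refine mem_leadingFormIdeal_of_sub_mem (esymmOn_isHomogeneous _ _) (hker fun i => ?_) hg
    refine hvan _ fun a ha => ?_
    obtain ⟨p, hp⟩ := hlt i a ha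
    exact ⟨p, Finset.mem_univ p, by rw [hp]⟩

/-- The index of the block of `σ` containing the letter `p + 1`. -/
noncomputable def OSP.blockIndex {n m : ℕ} (σ : OSP n m) (p : Fin n) : Fin m :=
  (σ.cover ((p : ℕ) + 1) (Finset.mem_Icc.mpr ⟨Nat.succ_pos _, p.isLt⟩)).choose

lemma OSP.blockIndex_eq_iff {n m : ℕ} (σ : OSP n m) {p : Fin n} {j : Fin m} :
    σ.blockIndex p = j ↔ (p : ℕ) + 1 ∈ σ.blocks j := by
  have hspec : (p : ℕ) + 1 ∈ σ.blocks (σ.blockIndex p) :=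
    (σ.cover ((p : ℕ) + 1) (Finset.mem_Icc.mpr ⟨Nat.succ_pos _, p.isLt⟩)).choose_spec
  exact ⟨fun h => h ▸ hspec, fun h => σ.eq_of_mem hspec h⟩

lemma OSP.mem_blocks_iff {n m : ℕ} (σ : OSP n m) {x : ℕ} {j : Fin m} :
    x ∈ σ.blocks j ↔ ∃ p : Fin n, (p : ℕ) + 1 = x ∧ σ.blockIndex p = j := by
  constructor
  · intro hx
    have hxn := Finset.mem_Icc.mp (σ.subset_range j hx)
    refine ⟨⟨x - 1, by omega⟩, by simp only; omega, σ.blockIndex_eq_iff.mpr ?_⟩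
    rwa [show x - 1 + 1 = x by omega]
  · rintro ⟨p, rfl, hp⟩
    exact σ.blockIndex_eq_iff.mp hp

lemma OSP.blockIndex_surjective {n m : ℕ} (σ : OSP n m) : Function.Surjective σ.blockIndex := by
  intro j
  obtain ⟨x, hx⟩ := σ.blocks_nonempty j
  obtain ⟨p, -, hp⟩ := σ.mem_blocks_iff.mp hx
  exact ⟨p, hp⟩

lemma OSP.lt_iff_exists_blockIndex {n m : ℕ} (σ : OSP n m) {a : ℕ} :
    a < m ↔ ∃ p, (σ.blockIndex p : ℕ) = a := by
  constructor
  · intro ha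
    obtain ⟨p, hp⟩ := σ.blockIndex_surjective ⟨a, ha⟩
    exact ⟨p, by rw [hp]⟩
  · rintro ⟨p, rfl⟩
    exact (σ.blockIndex p).isLt

lemma OSP.sigma_blockIndex_injective {n : ℕ} : Function.Injective
    fun (σ : (m : ℕ) × OSP n m) (p : Fin n) => (σ.2.blockIndex p : ℕ) := by
  rintro ⟨m, σ⟩ ⟨m', σ'⟩ h
  have hval : ∀ p, (σ.blockIndex p : ℕ) = σ'.blockIndex p := fun p => congrFun h p
  have hm : ∀ a, a < m ↔ a < m' := fun a => by
    rw [σ.lt_iff_exists_blockIndex, σ'.lt_iff_exists_blockIndex]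
    simp only [hval]
  obtain rfl : m = m' :=
    le_antisymm (le_of_not_gt fun h => lt_irrefl _ ((hm _).mp h))
      (le_of_not_gt fun h => lt_irrefl _ ((hm _).mpr h))
  have hblocks : σ.blocks = σ'.blocks := by
    ext j x
    rw [σ.mem_blocks_iff, σ'.mem_blocks_iff]
    simp only [Fin.ext_iff, hval]
  cases σ
  cases σ'
  cases hblocks
  rfl

instance OSP.finite_sigma {n : ℕ} : Finite ((m : ℕ) × OSP n m) := by
  have hlt : ∀ (σ : (m : ℕ) × OSP n m) (p : Fin n), (σ.2.blockIndex p : ℕ) < n := fun σ p =>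
    (σ.2.blockIndex p).isLt.trans_le
      (by simpa using Fintype.card_le_of_surjective _ σ.2.blockIndex_surjective)
  refine Finite.of_injective
    (fun (σ : (m : ℕ) × OSP n m) (p : Fin n) => (⟨σ.2.blockIndex p, hlt σ p⟩ : Fin n))
    fun σ σ' h => OSP.sigma_blockIndex_injective (funext fun p => ?_)
  exact congrArg Fin.val (congrFun h p)

lemma span_range_mk_eq_top_iff {n : ℕ} {J : Ideal (MvPolynomial (Fin n) ℚ)} {κ : Type*}
    (f : κ → MvPolynomial (Fin n) ℚ) :
    Submodule.span ℚ (Set.range fun i => Ideal.Quotient.mk J (f i)) = ⊤ ↔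
      Submodule.span ℚ (Set.range f) ⊔ J.restrictScalars ℚ = ⊤ := by
  have hrange : LinearMap.range (Ideal.Quotient.mkₐ ℚ J).toLinearMap = ⊤ :=
    LinearMap.range_eq_top.mpr (Ideal.Quotient.mkₐ_surjective ℚ J)
  have hker : LinearMap.ker (Ideal.Quotient.mkₐ ℚ J).toLinearMap = J.restrictScalars ℚ := by
    ext g
    exact Ideal.Quotient.eq_zero_iff_mem
  rw [← hker, ← LinearMap.map_eq_top_iff hrange, Submodule.map_span, ← Set.range_comp]
  rfl

lemma prod_univ_X_pow_eq_monomial {n : ℕ} (c : Fin n → ℕ) :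
    (∏ q : Fin n, MvPolynomial.X q ^ c q : MvPolynomial (Fin n) ℚ) =
      MvPolynomial.monomial (Finsupp.equivFunOnFinite.symm c) 1 := by
  rw [MvPolynomial.monomial_eq, Finsupp.prod_fintype _ _ fun _ => pow_zero _]
  simp

/-- for `1 ≤ k ≤ n`, the images in `S_{n,k}` of the monomials
`x_1^{c_1} ⋯ x_n^{c_n}`, as `(c_1, …, c_n)` ranges over the boosted coinversion codes of
the ordered set partitions of `[n]` with at least `k` blocks, form a `ℚ`-basis of `S_{n,k}`. -/
theorem Snk_monomial_basis (n k : ℕ) (hk : 1 ≤ k) (hkn : k ≤ n) :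
    LinearIndependent ℚ (fun p : {p : (m : ℕ) × OSP n m // k ≤ p.1} =>
      Ideal.Quotient.mk (Jnk n k) (∏ q : Fin n, MvPolynomial.X q ^ bcode p.1.2 q)) ∧
    Submodule.span ℚ (Set.range (fun p : {p : (m : ℕ) × OSP n m // k ≤ p.1} =>
      Ideal.Quotient.mk (Jnk n k) (∏ q : Fin n, MvPolynomial.X q ^ bcode p.1.2 q))) = ⊤ := by
  simp only [prod_univ_X_pow_eq_monomial]
  have htop : Submodule.span ℚ (Set.range (fun p : {p : (m : ℕ) × OSP n m // k ≤ p.1} =>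
      Ideal.Quotient.mk (Jnk n k)
        (MvPolynomial.monomial (Finsupp.equivFunOnFinite.symm (bcode p.1.2)) (1 : ℚ)))) = ⊤ := by
    rw [span_range_mk_eq_top_iff]
    have h := span_monomial_sup_Jnk_eq_top hkn (C := Set.range
      fun p : {p : (m : ℕ) × OSP n m // k ≤ p.1} => Finsupp.equivFunOnFinite.symm (bcode p.1.2))
      fun c hc hle => by
        obtain ⟨σ, hσ⟩ := exists_bcode_eq c (hk.trans hc) hle
        exact ⟨⟨⟨_, σ⟩, hc⟩, by
          simp only [hσ]
          exact Finsupp.equivFunOnFinite.symm_apply_apply c⟩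
    rwa [← Set.range_comp] at h
  refine ⟨?_, htop⟩
  classical
  have := Fintype.ofFinite {p : (m : ℕ) × OSP n m // k ≤ p.1}
  rw [linearIndependent_iff_notMem_span]
  intro i hi
  set v := fun p : {p : (m : ℕ) × OSP n m // k ≤ p.1} => Ideal.Quotient.mk (Jnk n k)
    (MvPolynomial.monomial (Finsupp.equivFunOnFinite.symm (bcode p.1.2)) (1 : ℚ)) with hv
  have hspan : Submodule.span ℚ (Set.range fun p : {p // p ≠ i} => v p.1) = ⊤ := by
    have hset : (Set.range fun p : {p // p ≠ i} => v p.1) = v '' (Set.univ \ {i}) := by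
      ext y
      simp
    rw [hset, eq_top_iff, ← htop, Submodule.span_le]
    rintro _ ⟨p, rfl⟩
    by_cases hp : p = i
    · exact hp ▸ hi
    · exact Submodule.subset_span ⟨p, by simpa using hp, rfl⟩
  rw [span_range_mk_eq_top_iff] at hspan
  let w : {p : (m : ℕ) × OSP n m // k ≤ p.1} → Fin n → ℕ := fun p q => p.1.2.blockIndex q
  have hJ : Jnk n k ≤ leadingFormIdeal (RingHom.ker (evalAt fun p q => (w p q : ℚ))) :=
    Jnk_le_leadingFormIdeal
      (fun p a ha => p.1.2.lt_iff_exists_blockIndex.mp (ha.trans_le p.2))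
      (fun p q a ha => p.1.2.lt_iff_exists_blockIndex.mp (ha.trans (p.1.2.blockIndex q).isLt))
  have hinj : Function.Injective fun p q => (w p q : ℚ) := fun p p' h =>
    Subtype.ext (OSP.sigma_blockIndex_injective (funext fun q =>
      Nat.cast_injective (R := ℚ) (congrFun h q)))
  have hcard := card_le_card_of_span_monomial_sup_eq_top hinj hJ
    (fun p : {p // p ≠ i} => Finsupp.equivFunOnFinite.symm (bcode p.1.1.2)) hspan
  exact absurd hcard (not_le_of_gt (Fintype.card_subtype_lt (x := i) (by simp)))

end PackedWords
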